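/- arXiv:1811.01878 — 2 statements merged into one kernel-verified Lean document; each statement's English description precedes it below -/
import Mathlib

section
/- Let z ∈ ℂ ∖ [0, ∞) and let √z be the branch of the square root with Im √z > 0. Then for every smooth compactly supported function φ : ℝ³ → ℂ and every x ∈ ℝ³: φ(x) = (1/4π) ∫_{ℝ³} (e^{i√z|x−x′|}/|x−x′|) · (−Δφ(x′) − zφ(x′)) dx′, where Δφ = ∂²φ/∂x₁² + ∂²φ/∂x₂² + ∂²φ/∂x₃² is the Laplacian of φ. -/
open InnerProductSpace MeasureTheory Complex

/-- The branch of the complex square root with positive imaginary part,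
defined off the ray `[0, ∞)`. -/
noncomputable def sqrtB (z : ℂ) : ℂ := Complex.I * (-z) ^ ((1 : ℂ) / 2)

/-- The Laplacian `Δφ = ∑ᵢ ∂²φ/∂xᵢ²` of a function on `ℝ³`. -/
noncomputable def lap (φ : EuclideanSpace ℝ (Fin 3) → ℂ) (x : EuclideanSpace ℝ (Fin 3)) : ℂ :=
  ∑ i : Fin 3,
    fderiv ℝ (fun y => fderiv ℝ φ y (EuclideanSpace.single i (1 : ℝ))) x
      (EuclideanSpace.single i (1 : ℝ))

section

open Set Filter Topology Metric

/-- Integration in polar coordinates. -/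
theorem integral_eq_integral_sphere_integral_Ioi {E F : Type*} [NormedAddCommGroup E]
    [NormedSpace ℝ E] [FiniteDimensional ℝ E] [Nontrivial E] [MeasurableSpace E] [BorelSpace E]
    [NormedAddCommGroup F] [NormedSpace ℝ F] (μ : Measure E) [μ.IsAddHaarMeasure]
    {f : E → F} (hf : Integrable f μ) :
    ∫ y, f y ∂μ = ∫ σ : sphere (0 : E) 1,
      (∫ r in Ioi (0 : ℝ), r ^ (Module.finrank ℝ E - 1) • f (r • (σ : E))) ∂μ.toSphere := by
  have hmp := μ.measurePreserving_homeomorphUnitSphereProd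
  have hemb := (homeomorphUnitSphereProd E).measurableEmbedding
  have hcomp (x : ({0}ᶜ : Set E)) : f ((homeomorphUnitSphereProd E x).2.1 •
      ((homeomorphUnitSphereProd E x).1 : E)) = f x := by
    congr 1
    exact congrArg Subtype.val ((homeomorphUnitSphereProd E).symm_apply_apply x)
  have hint : Integrable (fun p : sphere (0 : E) 1 × Ioi (0 : ℝ) => f (p.2.1 • (p.1 : E)))
      (μ.toSphere.prod (.volumeIoiPow (Module.finrank ℝ E - 1))) := by
    rw [← hmp.integrable_comp_emb hemb]
    simp only [Function.comp_def, hcomp]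
    exact (integrableOn_iff_comap_subtypeVal (measurableSet_singleton _).compl).1 hf.integrableOn
  calc
    ∫ y, f y ∂μ = ∫ y : ({0}ᶜ : Set E), f y ∂(μ.comap (↑)) := by
      rw [integral_subtype_comap (measurableSet_singleton _).compl f, restrict_compl_singleton]
    _ = ∫ p : sphere (0 : E) 1 × Ioi (0 : ℝ), f (p.2.1 • (p.1 : E))
        ∂(μ.toSphere.prod (.volumeIoiPow (Module.finrank ℝ E - 1))) := by
      rw [← hmp.integral_comp hemb]
      simp only [hcomp]
    _ = _ := by
      rw [integral_prod _ hint]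
      congr 1 with σ
      simp only [Measure.volumeIoiPow, ENNReal.ofReal]
      rw [integral_withDensity_eq_integral_smul, integral_subtype_comap measurableSet_Ioi
        fun a ↦ Real.toNNReal (a ^ (Module.finrank ℝ E - 1)) • f (a • (σ : E))]
      · refine setIntegral_congr_fun measurableSet_Ioi fun x hx => ?_
        rw [NNReal.smul_def, Real.coe_toNNReal _ (pow_nonneg hx.out.le _)]
      · fun_prop

theorem integrable_inv_norm_pow_mul_norm {F : Type*} [NormedAddCommGroup F]
    {u : EuclideanSpace ℝ (Fin 3) → F} (hu : Continuous u) (hs : HasCompactSupport u)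
    {n : ℕ} (hn : n ≤ 2) :
    Integrable fun y => (‖y‖ ^ n)⁻¹ * ‖u y‖ := by
  obtain ⟨C, hC⟩ := hs.exists_bound_of_continuous hu
  obtain ⟨R, hR⟩ := hs.isBounded.subset_ball (0 : EuclideanSpace ℝ (Fin 3))
  have hball : Integrable fun y : EuclideanSpace ℝ (Fin 3) =>
      (Iio R).indicator (fun r : ℝ => (r ^ n)⁻¹) ‖y‖ := by
    rw [integrable_fun_norm_addHaar volume]
    have h1 : IntegrableOn (fun r : ℝ => r ^ (2 - n)) (Ioo 0 R) :=
      (continuous_pow _).continuousOn.integrableOn_Icc.mono_set Ioo_subset_Icc_self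
    refine ((integrable_indicator_iff measurableSet_Ioo).2 h1).integrableOn.congr_fun
      (fun r (hr : 0 < r) => ?_) measurableSet_Ioi
    by_cases hrR : r < R
    · simp [hr, hrR, pow_sub₀ r hr.ne' hn]
    · simp [hrR]
  refine (hball.mul_const C).mono' ?_ (Eventually.of_forall fun y => ?_)
  · exact (by fun_prop : Measurable fun y : EuclideanSpace ℝ (Fin 3) =>
      (‖y‖ ^ n)⁻¹).aestronglyMeasurable.mul hu.norm.aestronglyMeasurable
  · have hC0 : 0 ≤ C := (norm_nonneg _).trans (hC 0)
    simp only [Real.norm_of_nonneg (show 0 ≤ (‖y‖ ^ n)⁻¹ * ‖u y‖ by positivity), indicator_apply,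
      mem_Iio]
    by_cases hy : y ∈ tsupport u
    · have : ‖y‖ < R := by simpa using hR hy
      rw [if_pos this]
      gcongr
      exact hC y
    · rw [image_eq_zero_of_notMem_tsupport hy, norm_zero, mul_zero]
      split_ifs <;> positivity

theorem integrable_expKernel_mul (k : ℂ) {u : EuclideanSpace ℝ (Fin 3) → ℂ}
    (hu : Continuous u) (hs : HasCompactSupport u) :
    Integrable fun y => exp (I * k * (‖y‖ : ℂ)) / (‖y‖ : ℂ) * u y := by
  refine (integrable_inv_norm_pow_mul_norm (u := fun y => exp (I * k * (‖y‖ : ℂ)) * u y)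
    (by fun_prop) hs.mul_left (n := 1) (by norm_num)).mono' ?_ (Eventually.of_forall fun y => ?_)
  · exact (by fun_prop : Measurable fun y : EuclideanSpace ℝ (Fin 3) =>
      exp (I * k * (‖y‖ : ℂ)) / (‖y‖ : ℂ)).aestronglyMeasurable.mul hu.aestronglyMeasurable
  · simp only [norm_mul, norm_div, norm_real, norm_norm, pow_one]
    exact le_of_eq (by ring)

theorem integrable_expKernel_deriv_mul (k : ℂ) {ψ : EuclideanSpace ℝ (Fin 3) → ℂ}
    (hψ : ContDiff ℝ 1 ψ) (hs : HasCompactSupport ψ) :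
    Integrable fun y => (I * k * (‖y‖ : ℂ) - 1) * exp (I * k * (‖y‖ : ℂ)) / (‖y‖ : ℂ) ^ 3 *
      fderiv ℝ ψ y y := by
  have hd : Continuous (fderiv ℝ ψ) := hψ.continuous_fderiv one_ne_zero
  refine (integrable_inv_norm_pow_mul_norm (u := fun y =>
      ‖(I * k * (‖y‖ : ℂ) - 1) * exp (I * k * (‖y‖ : ℂ))‖ * ‖fderiv ℝ ψ y‖)
    (by fun_prop) (hs.fderiv ℝ).norm.mul_left (n := 2) le_rfl).mono' ?_
    (Eventually.of_forall fun y => ?_)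
  · exact (by fun_prop : Measurable fun y : EuclideanSpace ℝ (Fin 3) =>
      (I * k * (‖y‖ : ℂ) - 1) * exp (I * k * (‖y‖ : ℂ)) /
        (‖y‖ : ℂ) ^ 3).aestronglyMeasurable.mul (hd.clm_apply continuous_id).aestronglyMeasurable
  · rcases eq_or_ne y 0 with rfl | hy
    · simp
    have hy' : 0 < ‖y‖ := norm_pos_iff.2 hy
    rw [norm_mul, norm_div, norm_pow, norm_real, norm_norm, Real.norm_of_nonneg (by positivity)]
    calc _ ≤ ‖(I * k * (‖y‖ : ℂ) - 1) * exp (I * k * (‖y‖ : ℂ))‖ / ‖y‖ ^ 3 *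
          (‖fderiv ℝ ψ y‖ * ‖y‖) := by gcongr; exact (fderiv ℝ ψ y).le_opNorm y
      _ = _ := by field_simp

theorem integral_Ioi_radial (k : ℂ) {ψ : EuclideanSpace ℝ (Fin 3) → ℂ}
    (hψ : ContDiff ℝ 1 ψ) (hs : HasCompactSupport ψ) {σ : EuclideanSpace ℝ (Fin 3)}
    (hσ : ‖σ‖ = 1) :
    ∫ r in Ioi (0 : ℝ), r ^ 2 •
      ((I * k * (‖r • σ‖ : ℂ) - 1) * exp (I * k * (‖r • σ‖ : ℂ)) / (‖r • σ‖ : ℂ) ^ 3 *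
        fderiv ℝ ψ (r • σ) (r • σ) -
      k ^ 2 * (exp (I * k * (‖r • σ‖ : ℂ)) / (‖r • σ‖ : ℂ) * ψ (r • σ))) = ψ 0 := by
  have hσ0 : σ ≠ 0 := norm_ne_zero_iff.1 (by simp [hσ])
  set w : ℝ → ℂ := fun r => (I * k * r - 1) * exp (I * k * r) * ψ (r • σ) with hw
  have hwc : ContDiff ℝ 1 w := by
    have : ContDiff ℝ 1 (fun r : ℝ => (r : ℂ)) := ofRealCLM.contDiff
    have h2 : ContDiff ℝ 1 (fun r : ℝ => exp (I * k * r)) := by fun_prop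
    fun_prop
  have hws : HasCompactSupport w :=
    (hs.comp_isClosedEmbedding (isClosedEmbedding_smul_left hσ0)).mul_left
  have hwd (r : ℝ) : HasDerivAt w ((I * k * r - 1) * exp (I * k * r) * fderiv ℝ ψ (r • σ) σ -
      k ^ 2 * (r * exp (I * k * r) * ψ (r • σ))) r := by
    have h1 : HasDerivAt (fun r : ℝ => I * k * r) (I * k) r := by
      simpa using (hasDerivAt_id r).ofReal_comp.const_mul (I * k)
    have h2 : HasDerivAt (fun r : ℝ => r • σ) σ r := by
      simpa using (hasDerivAt_id r).smul_const σ
    have h3 : HasDerivAt (fun r : ℝ => ψ (r • σ)) (fderiv ℝ ψ (r • σ) σ) r :=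
      ((hψ.differentiable one_ne_zero _).hasFDerivAt).comp_hasDerivAt r h2
    refine (((h1.sub_const 1).fun_mul h1.cexp).fun_mul h3).congr_deriv ?_
    linear_combination (k ^ 2 * r * exp (I * k * r) * ψ (r • σ)) * I_sq
  have h0 : ψ 0 = -w 0 := by simp [hw]
  rw [h0, ← hws.integral_Ioi_deriv_eq hwc 0]
  refine setIntegral_congr_fun measurableSet_Ioi fun r (hr : 0 < r) => ?_
  have hr' : (r : ℂ) ≠ 0 := ofReal_ne_zero.2 hr.ne'
  simp only [(hwd r).deriv, norm_smul, hσ, mul_one, Real.norm_of_nonneg hr.le, map_smul,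
    real_smul, ofReal_pow]
  field_simp

theorem integral_expKernel_deriv_sub (k : ℂ) {ψ : EuclideanSpace ℝ (Fin 3) → ℂ}
    (hψ : ContDiff ℝ 1 ψ) (hs : HasCompactSupport ψ) :
    (∫ y, (I * k * (‖y‖ : ℂ) - 1) * exp (I * k * (‖y‖ : ℂ)) / (‖y‖ : ℂ) ^ 3 * fderiv ℝ ψ y y) -
      k ^ 2 * ∫ y, exp (I * k * (‖y‖ : ℂ)) / (‖y‖ : ℂ) * ψ y = 4 * (Real.pi : ℂ) * ψ 0 := by
  have h1 := integrable_expKernel_deriv_mul k hψ hs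
  have h2 := (integrable_expKernel_mul k hψ.continuous hs).const_mul (k ^ 2)
  rw [← integral_const_mul, ← integral_sub h1 h2]
  refine (integral_eq_integral_sphere_integral_Ioi volume (h1.sub h2)).trans ?_
  simp only [finrank_euclideanSpace, Fintype.card_fin, Nat.add_one_sub_one]
  have (σ : sphere (0 : EuclideanSpace ℝ (Fin 3)) 1) :=
    integral_Ioi_radial k hψ hs (norm_eq_of_mem_sphere σ)
  simp only [Pi.sub_apply, this]
  rw [integral_const, Measure.toSphere_real_apply_univ, measureReal_def,
    EuclideanSpace.volume_ball_fin_three]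
  rw [ENNReal.ofReal_one, one_pow, one_mul, ENNReal.toReal_ofReal (by positivity)]
  simp only [finrank_euclideanSpace, Fintype.card_fin, real_smul]
  push_cast
  ring

theorem im_sqrtB_nonneg (z : ℂ) : 0 ≤ (sqrtB z).im := by
  rcases eq_or_ne z 0 with rfl | hz
  · simp [sqrtB]
  have hz' : -z ≠ 0 := neg_ne_zero.2 hz
  rw [sqrtB, I_mul_im, cpow_def_of_ne_zero hz', exp_re]
  refine mul_nonneg (Real.exp_pos _).le (Real.cos_nonneg_of_mem_Icc ?_)
  have : (log (-z) * (1 / 2)).im = (-z).arg / 2 := by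
    rw [show (1 / 2 : ℂ) = ((1 / 2 : ℝ) : ℂ) by norm_num, im_mul_ofReal, log_im]; ring
  rw [this]
  constructor <;> linarith [neg_pi_lt_arg (-z), arg_le_pi (-z)]

theorem sqrtB_sq (z : ℂ) : sqrtB z ^ 2 = z := by
  rw [sqrtB, mul_pow, one_div, cpow_ofNat_inv_pow, I_sq]
  ring

theorem norm_exp_I_mul_le_one {k : ℂ} (hk : 0 ≤ k.im) {s : ℝ} (hs : 0 ≤ s) :
    ‖exp (I * k * s)‖ ≤ 1 := by
  rw [norm_exp, Real.exp_le_one_iff]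
  simp
  positivity

theorem lap_comp_const_sub {φ : EuclideanSpace ℝ (Fin 3) → ℂ} (hφ : ContDiff ℝ 2 φ)
    (x y : EuclideanSpace ℝ (Fin 3)) :
    lap (fun y => φ (x - y)) y = lap φ (x - y) := by
  have h {f : EuclideanSpace ℝ (Fin 3) → ℂ} (hf : Differentiable ℝ f) (y v) :
      fderiv ℝ (fun y => f (x - y)) y v = -fderiv ℝ f (x - y) v := by
    have := (hf (x - y)).hasFDerivAt.comp y ((hasFDerivAt_id y).const_sub x)
    rw [show (fun y => f (x - y)) = f ∘ HSub.hSub x from rfl, this.fderiv]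
    simp
  have hd (i : Fin 3) :
      Differentiable ℝ fun y => fderiv ℝ φ y (EuclideanSpace.single i (1 : ℝ)) :=
    ((hφ.fderiv_right (m := 1) (by norm_num)).clm_apply contDiff_const).differentiable one_ne_zero
  simp only [lap, h (hφ.differentiable two_ne_zero), fderiv_fun_neg, neg_apply, h (hd _), neg_neg]

theorem continuous_lap {φ : EuclideanSpace ℝ (Fin 3) → ℂ} (hφ : ContDiff ℝ 2 φ) :
    Continuous (lap φ) := by
  refine continuous_finsetSum _ fun i _ => ?_
  have : ContDiff ℝ 1 fun y => fderiv ℝ φ y (EuclideanSpace.single i (1 : ℝ)) :=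
    (hφ.fderiv_right (by norm_num)).clm_apply contDiff_const
  exact (this.continuous_fderiv one_ne_zero).clm_apply continuous_const

theorem HasCompactSupport.lap {φ : EuclideanSpace ℝ (Fin 3) → ℂ} (hs : HasCompactSupport φ) :
    HasCompactSupport (lap φ) := by
  have := fun i : Fin 3 => (hs.fderiv_apply ℝ (EuclideanSpace.single i (1 : ℝ))).fderiv_apply ℝ
    (EuclideanSpace.single i (1 : ℝ))
  unfold _root_.lap
  simp only [Fin.sum_univ_three]
  exact ((this 0).add (this 1)).add (this 2)

/-- The regularised distance `√(|y|² + ε²)` from the origin. -/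
noncomputable def regNorm (ε : ℝ) (y : EuclideanSpace ℝ (Fin 3)) : ℝ := √(‖y‖ ^ 2 + ε ^ 2)

theorem regNorm_pos {ε : ℝ} (hε : 0 < ε) (y : EuclideanSpace ℝ (Fin 3)) : 0 < regNorm ε y := by
  unfold regNorm; positivity

theorem norm_le_regNorm (ε : ℝ) (y : EuclideanSpace ℝ (Fin 3)) : ‖y‖ ≤ regNorm ε y :=
  Real.le_sqrt_of_sq_le (by nlinarith [sq_nonneg ε])

theorem continuous_regNorm (ε : ℝ) : Continuous (regNorm ε) := by
  unfold regNorm; fun_prop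

theorem tendsto_regNorm (y : EuclideanSpace ℝ (Fin 3)) :
    Tendsto (fun ε => regNorm ε y) (𝓝[>] 0) (𝓝 ‖y‖) := by
  have : Continuous fun ε => regNorm ε y := by unfold regNorm; fun_prop
  simpa [regNorm] using (this.tendsto 0).mono_left nhdsWithin_le_nhds

theorem hasFDerivAt_regNorm {ε : ℝ} (hε : 0 < ε) (y : EuclideanSpace ℝ (Fin 3)) :
    HasFDerivAt (regNorm ε) ((regNorm ε y)⁻¹ • innerSL ℝ y) y := by
  have h := ((hasStrictFDerivAt_norm_sq y).hasFDerivAt.add_const (ε ^ 2)).sqrt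
    (by positivity : ‖y‖ ^ 2 + ε ^ 2 ≠ 0)
  refine h.congr_fderiv ?_
  ext v
  simp [regNorm]
  ring

theorem hasFDerivAt_regKernel (k : ℂ) {ε : ℝ} (hε : 0 < ε) (y : EuclideanSpace ℝ (Fin 3)) :
    HasFDerivAt (fun y => exp (I * k * (regNorm ε y : ℂ)) / (regNorm ε y : ℂ))
      (((innerSL ℝ y).smulRight ((I * k * (regNorm ε y : ℂ) - 1) *
        exp (I * k * (regNorm ε y : ℂ)) / (regNorm ε y : ℂ) ^ 3))) y := by
  have hs : (regNorm ε y : ℂ) ≠ 0 := ofReal_ne_zero.2 (regNorm_pos hε y).ne'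
  have hg : HasDerivAt (fun s : ℝ => exp (I * k * (s : ℂ)) / (s : ℂ))
      ((I * k * (regNorm ε y : ℂ) - 1) * exp (I * k * (regNorm ε y : ℂ)) /
        (regNorm ε y : ℂ) ^ 2) (regNorm ε y) := by
    have h0 := (hasDerivAt_id (regNorm ε y)).ofReal_comp
    have h1 : HasDerivAt (fun s : ℝ => I * k * s) (I * k) (regNorm ε y) := by
      simpa using h0.const_mul (I * k)
    refine (h1.cexp.div h0 hs).congr_deriv ?_
    simp
    ring
  refine (hg.hasFDerivAt.comp y (hasFDerivAt_regNorm hε y)).congr_fderiv ?_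
  ext v
  simp
  field_simp

theorem integral_regKernel_mul_lap (k : ℂ) {ψ : EuclideanSpace ℝ (Fin 3) → ℂ}
    (hψ : ContDiff ℝ 2 ψ) (hs : HasCompactSupport ψ) {ε : ℝ} (hε : 0 < ε) :
    ∫ y, exp (I * k * (regNorm ε y : ℂ)) / (regNorm ε y : ℂ) * lap ψ y =
      -∫ y, (I * k * (regNorm ε y : ℂ) - 1) * exp (I * k * (regNorm ε y : ℂ)) /
        (regNorm ε y : ℂ) ^ 3 * fderiv ℝ ψ y y := by
  set G : EuclideanSpace ℝ (Fin 3) → ℂ :=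
    fun y => exp (I * k * (regNorm ε y : ℂ)) / (regNorm ε y : ℂ) with hG
  set H : EuclideanSpace ℝ (Fin 3) → ℂ := fun y => (I * k * (regNorm ε y : ℂ) - 1) *
    exp (I * k * (regNorm ε y : ℂ)) / (regNorm ε y : ℂ) ^ 3 with hH
  have hr := continuous_regNorm ε
  have hne (y) : (regNorm ε y : ℂ) ≠ 0 := ofReal_ne_zero.2 (regNorm_pos hε y).ne'
  have hGc : Continuous G := Continuous.div (by fun_prop) (by fun_prop) hne
  have hHc : Continuous H :=
    Continuous.div (by fun_prop) (by fun_prop) fun y => pow_ne_zero 3 (hne y)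
  have hGd (y v) : fderiv ℝ G y v = H y * inner ℝ y v := by
    rw [(hasFDerivAt_regKernel k hε y).fderiv]
    simp [hH, mul_comm]
  let e (i : Fin 3) : EuclideanSpace ℝ (Fin 3) := EuclideanSpace.single i 1
  let D (i : Fin 3) (y : EuclideanSpace ℝ (Fin 3)) : ℂ := fderiv ℝ ψ y (e i)
  have hD (i) : ContDiff ℝ 1 (D i) := (hψ.fderiv_right (by norm_num)).clm_apply contDiff_const
  have hDs (i) : HasCompactSupport (D i) := hs.fderiv_apply ℝ _
  have hDD (i) : Continuous fun y => fderiv ℝ (D i) y (e i) :=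
    ((hD i).continuous_fderiv one_ne_zero).clm_apply continuous_const
  have hint1 (i) : Integrable fun y => G y * fderiv ℝ (D i) y (e i) :=
    (hGc.mul (hDD i)).integrable_of_hasCompactSupport ((hDs i).fderiv_apply ℝ _).mul_left
  have hint2 (i) : Integrable fun y => fderiv ℝ G y (e i) * D i y := by
    simp only [hGd]
    have := (hD i).continuous
    exact Continuous.integrable_of_hasCompactSupport (by fun_prop) (hDs i).mul_left
  have hparts (i) : ∫ y, G y * fderiv ℝ (D i) y (e i) = -∫ y, fderiv ℝ G y (e i) * D i y :=
    integral_mul_fderiv_eq_neg_fderiv_mul_of_integrable (hint2 i) (hint1 i)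
      ((hGc.mul (hD i).continuous).integrable_of_hasCompactSupport (hDs i).mul_left)
      (fun y _ => (hasFDerivAt_regKernel k hε y).differentiableAt)
      (fun y _ => (hD i).differentiable one_ne_zero y)
  have hsum (y) : ∑ i, fderiv ℝ G y (e i) * D i y = H y * fderiv ℝ ψ y y := by
    have hy : y = ∑ i, y i • e i := by
      simpa using ((EuclideanSpace.basisFun (Fin 3) ℝ).sum_repr y).symm
    have hyψ : fderiv ℝ ψ y y = fderiv ℝ ψ y (∑ i, y i • e i) := by rw [← hy]
    rw [hyψ, map_sum, Finset.mul_sum]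
    refine Finset.sum_congr rfl fun i _ => ?_
    simp [hGd, D, e, EuclideanSpace.inner_single_right]
    ring
  calc ∫ y, G y * lap ψ y = ∫ y, ∑ i, G y * fderiv ℝ (D i) y (e i) := by
        simp only [lap, Finset.mul_sum, D, e]
    _ = -∫ y, ∑ i, fderiv ℝ G y (e i) * D i y := by
        rw [integral_finsetSum _ fun i _ => hint1 i, integral_finsetSum _ fun i _ => hint2 i,
          ← Finset.sum_neg_distrib]
        exact Finset.sum_congr rfl fun i _ => hparts i
    _ = _ := by simp only [hsum, hH]

theorem integral_expKernel_mul_lap {k : ℂ} (hk : 0 ≤ k.im) {ψ : EuclideanSpace ℝ (Fin 3) → ℂ}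
    (hψ : ContDiff ℝ 2 ψ) (hs : HasCompactSupport ψ) :
    ∫ y, exp (I * k * (‖y‖ : ℂ)) / (‖y‖ : ℂ) * lap ψ y =
      -∫ y, (I * k * (‖y‖ : ℂ) - 1) * exp (I * k * (‖y‖ : ℂ)) / (‖y‖ : ℂ) ^ 3 *
        fderiv ℝ ψ y y := by
  have hd : Continuous (fderiv ℝ ψ) := hψ.continuous_fderiv two_ne_zero
  have hlap := continuous_lap hψ
  have hr (ε) := continuous_regNorm ε
  have hae : ∀ᵐ y : EuclideanSpace ℝ (Fin 3), y ≠ 0 := by simp [ae_iff]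
  have hlim (y : EuclideanSpace ℝ (Fin 3)) :
      Tendsto (fun ε => (regNorm ε y : ℂ)) (𝓝[>] 0) (𝓝 (‖y‖ : ℂ)) :=
    (continuous_ofReal.tendsto _).comp (tendsto_regNorm y)
  have hlimE (y : EuclideanSpace ℝ (Fin 3)) :
      Tendsto (fun ε => exp (I * k * (regNorm ε y : ℂ))) (𝓝[>] 0) (𝓝 (exp (I * k * (‖y‖ : ℂ)))) :=
    ((hlim y).const_mul (I * k)).cexp
  have hA : Tendsto (fun ε => ∫ y, exp (I * k * (regNorm ε y : ℂ)) / (regNorm ε y : ℂ) * lap ψ y)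
      (𝓝[>] 0) (𝓝 (∫ y, exp (I * k * (‖y‖ : ℂ)) / (‖y‖ : ℂ) * lap ψ y)) := by
    refine tendsto_integral_filter_of_dominated_convergence (fun y => (‖y‖ ^ 1)⁻¹ * ‖lap ψ y‖)
      ?_ ?_ (integrable_inv_norm_pow_mul_norm hlap hs.lap (by norm_num)) ?_
    · refine Eventually.of_forall fun ε => Measurable.aestronglyMeasurable ?_
      have := (hr ε).measurable
      have := hlap.measurable
      fun_prop
    · filter_upwards [self_mem_nhdsWithin] with ε (hε : 0 < ε)
      filter_upwards [hae] with y hy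
      have hy' : 0 < ‖y‖ := norm_pos_iff.2 hy
      have hs := regNorm_pos hε y
      rw [norm_mul, norm_div, norm_real, Real.norm_of_nonneg hs.le, pow_one, ← one_div]
      gcongr
      · exact norm_exp_I_mul_le_one hk hs.le
      · exact norm_le_regNorm ε y
    · filter_upwards [hae] with y hy
      exact ((hlimE y).div (hlim y) (by simpa using hy)).mul_const _
  have hB : Tendsto (fun ε => -∫ y, (I * k * (regNorm ε y : ℂ) - 1) *
      exp (I * k * (regNorm ε y : ℂ)) / (regNorm ε y : ℂ) ^ 3 * fderiv ℝ ψ y y)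
      (𝓝[>] 0) (𝓝 (-∫ y, (I * k * (‖y‖ : ℂ) - 1) * exp (I * k * (‖y‖ : ℂ)) / (‖y‖ : ℂ) ^ 3 *
        fderiv ℝ ψ y y)) := by
    refine (tendsto_integral_filter_of_dominated_convergence
      (fun y => ‖k‖ * ((‖y‖ ^ 1)⁻¹ * ‖fderiv ℝ ψ y‖) + (‖y‖ ^ 2)⁻¹ * ‖fderiv ℝ ψ y‖) ?_ ?_
      (((integrable_inv_norm_pow_mul_norm hd (hs.fderiv ℝ) (by norm_num)).const_mul _).add
        (integrable_inv_norm_pow_mul_norm hd (hs.fderiv ℝ) le_rfl)) ?_).neg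
    · refine Eventually.of_forall fun ε => Measurable.aestronglyMeasurable ?_
      have := (hr ε).measurable
      have := (hd.clm_apply continuous_id).measurable
      simp only [id] at this
      fun_prop
    · filter_upwards [self_mem_nhdsWithin] with ε (hε : 0 < ε)
      filter_upwards [hae] with y hy
      have hy' : 0 < ‖y‖ := norm_pos_iff.2 hy
      have hs := regNorm_pos hε y
      have hys := norm_le_regNorm ε y
      set s := regNorm ε y
      have h1 : ‖I * k * (s : ℂ) - 1‖ ≤ ‖k‖ * s + 1 := by
        refine (norm_sub_le _ _).trans (le_of_eq ?_)
        simp [abs_of_pos hs]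
      rw [norm_mul, norm_div, norm_mul, norm_pow, norm_real, Real.norm_of_nonneg hs.le]
      calc _ ≤ (‖k‖ * s + 1) * 1 / s ^ 3 * (‖fderiv ℝ ψ y‖ * s) := by
            gcongr
            · exact norm_exp_I_mul_le_one hk hs.le
            · exact ((fderiv ℝ ψ y).le_opNorm y).trans (by gcongr)
        _ = ‖k‖ * ((s ^ 1)⁻¹ * ‖fderiv ℝ ψ y‖) + (s ^ 2)⁻¹ * ‖fderiv ℝ ψ y‖ := by
            field_simp
        _ ≤ _ := by gcongr
    · filter_upwards [hae] with y hy
      exact (((((hlim y).const_mul (I * k)).sub_const 1).mul (hlimE y)).div ((hlim y).pow 3)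
        (by simpa using hy)).mul_const _
  refine tendsto_nhds_unique (hA.congr' ?_) hB
  filter_upwards [self_mem_nhdsWithin] with ε hε
  exact integral_regKernel_mul_lap k hψ hs hε

end

theorem green_representation_formula
    (z : ℂ) (hz : ¬(z.im = 0 ∧ 0 ≤ z.re))
    (φ : EuclideanSpace ℝ (Fin 3) → ℂ)
    (hφ : ContDiff ℝ (⊤ : ℕ∞) φ) (hsupp : HasCompactSupport φ)
    (x : EuclideanSpace ℝ (Fin 3)) :
    φ x = (∫ x' : EuclideanSpace ℝ (Fin 3),
        Complex.exp (Complex.I * sqrtB z * (‖x - x'‖ : ℂ)) / (‖x - x'‖ : ℂ)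
          * (-lap φ x' - z * φ x')) / (4 * (Real.pi : ℂ)) := by
  set ψ : EuclideanSpace ℝ (Fin 3) → ℂ := fun y => φ (x - y) with hψdef
  have hφ2 : ContDiff ℝ 2 φ := mod_cast contDiff_infty.1 hφ 2
  have hψ : ContDiff ℝ 2 ψ := hφ2.comp (contDiff_const.sub contDiff_id)
  have hψs : HasCompactSupport ψ := hsupp.comp_homeomorph (Homeomorph.subLeft x)
  have hint1 := integrable_expKernel_mul (sqrtB z) (continuous_lap hψ) hψs.lap
  have hint2 := (integrable_expKernel_mul (sqrtB z) hψ.continuous hψs).const_mul z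
  have hshift := integral_sub_left_eq_self (fun y =>
    exp (I * sqrtB z * (‖y‖ : ℂ)) / (‖y‖ : ℂ) * (-lap φ (x - y) - z * φ (x - y))) volume x
  simp only [sub_sub_cancel] at hshift
  have hkey := integral_expKernel_deriv_sub (sqrtB z) (hψ.of_le one_le_two) hψs
  rw [← neg_eq_iff_eq_neg.2 (integral_expKernel_mul_lap (im_sqrtB_nonneg z) hψ hψs), sqrtB_sq,
    ← integral_const_mul, neg_sub_left, ← integral_add hint2 hint1, ← integral_neg] at hkey
  have hpi : (4 * (Real.pi : ℂ)) ≠ 0 := by simp [Real.pi_ne_zero]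
  rw [hshift, eq_div_iff hpi, mul_comm]
  simp only [hψdef, sub_zero] at hkey
  rw [← hkey]
  refine integral_congr_ae (Filter.Eventually.of_forall fun y => ?_)
  simp only [lap_comp_const_sub hφ2]
  ring
end

section
/- Fix l > 0 and z ∈ ℂ ∖ [0, ∞), with √z the branch of the square root satisfying Im √z > 0. The integral operator G(z) : L²([0, l]) → L²(ℝ³) defined by (G(z)u)(x) = ∫₀^l e^{i√z|x−(s,0,0)|}/(4π|x−(s,0,0)|) · u(s) ds is a well-defined bounded linear operator, and its operator norm satisfies ‖G(z)‖² ≤ l / (8π·Im √z). -/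
open InnerProductSpace MeasureTheory Complex

noncomputable abbrev L2R3 :=
  MeasureTheory.Lp ℂ 2 (volume : Measure (EuclideanSpace ℝ (Fin 3)))

/-- `L²([0, l])`. -/
noncomputable abbrev L2I (l : ℝ) :=
  MeasureTheory.Lp ℂ 2 (volume.restrict (Set.Icc (0 : ℝ) l))

/-- The embedding `s ↦ (s, 0, 0)` of `[0, l]` into `ℝ³`. -/
noncomputable def seg (s : ℝ) : EuclideanSpace ℝ (Fin 3) := EuclideanSpace.single 0 s

/-- The squared `L²` seminorm as a lower Lebesgue integral. -/
lemma eLpNorm_two_sq {α E : Type*} [MeasurableSpace α] [NormedAddCommGroup E]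
    (μ : Measure α) (f : α → E) :
    eLpNorm f 2 μ ^ 2 = ∫⁻ x, ‖f x‖ₑ ^ 2 ∂μ := by
  simpa using eLpNorm_nnreal_pow_eq_lintegral (μ := μ) (f := f) (p := 2) two_ne_zero

section HilbertSchmidt

variable {α β : Type*} [MeasurableSpace α] [MeasurableSpace β]

/-- The Cauchy–Schwarz inequality for a product of two `L²` functions. -/
lemma enorm_integral_mul_le {ν : Measure β} {k u : β → ℂ} (hk : AEStronglyMeasurable k ν)
    (hu : AEStronglyMeasurable u ν) :
    ‖∫ s, k s * u s ∂ν‖ₑ ≤ eLpNorm k 2 ν * eLpNorm u 2 ν := by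
  calc ‖∫ s, k s * u s ∂ν‖ₑ ≤ ∫⁻ s, ‖k s * u s‖ₑ ∂ν := enorm_integral_le_lintegral_enorm _
    _ = eLpNorm (k • u) 1 ν := by simp [eLpNorm_one_eq_lintegral_enorm]
    _ ≤ _ := eLpNorm_smul_le_mul_eLpNorm hu hk

/-- A square-integrable kernel defines a bounded operator between `L²` spaces, whose norm is at
most the `L²` norm of the kernel. -/
theorem exists_integralOperator_of_lintegral_sq_le {μ : Measure α} {ν : Measure β} [SFinite ν]
    {K : α → β → ℂ} (hK : StronglyMeasurable (Function.uncurry K)) {C : ℝ} (hC : 0 ≤ C)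
    (hKC : ∫⁻ x, ∫⁻ s, ‖K x s‖ₑ ^ 2 ∂ν ∂μ ≤ ENNReal.ofReal C) :
    ∃ G : Lp ℂ 2 ν →L[ℂ] Lp ℂ 2 μ,
      (∀ u : Lp ℂ 2 ν, (G u : α → ℂ) =ᵐ[μ] fun x => ∫ s, K x s * u s ∂ν) ∧ ‖G‖ ^ 2 ≤ C := by
  have hKx (x : α) : StronglyMeasurable (K x) := hK.comp_measurable measurable_prodMk_left
  have hmem : ∀ᵐ x ∂μ, MemLp (K x) 2 ν := by
    have hm : Measurable fun x => ∫⁻ s, ‖K x s‖ₑ ^ 2 ∂ν :=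
      (hK.enorm.pow_const 2).lintegral_prod_right'
    filter_upwards [ae_lt_top hm (hKC.trans_lt ENNReal.ofReal_lt_top).ne] with x hx
    refine ⟨(hKx x).aestronglyMeasurable, ?_⟩
    rw [← eLpNorm_two_sq] at hx
    simpa using hx
  have hint (u : Lp ℂ 2 ν) : ∀ᵐ x ∂μ, Integrable (fun s => K x s * u s) ν := by
    filter_upwards [hmem] with x hx using hx.integrable_mul (Lp.memLp u)
  have hbound (u : Lp ℂ 2 ν) :
      eLpNorm (fun x => ∫ s, K x s * u s ∂ν) 2 μ ≤ ENNReal.ofReal (√C) * ‖u‖ₑ := by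
    rw [← ENNReal.pow_le_pow_left_iff two_ne_zero, eLpNorm_two_sq, mul_pow,
      ← ENNReal.ofReal_pow (Real.sqrt_nonneg C), Real.sq_sqrt hC]
    calc ∫⁻ x, ‖∫ s, K x s * u s ∂ν‖ₑ ^ 2 ∂μ
        ≤ ∫⁻ x, (∫⁻ s, ‖K x s‖ₑ ^ 2 ∂ν) * ‖u‖ₑ ^ 2 ∂μ := by
          refine lintegral_mono fun x => ?_
          rw [← eLpNorm_two_sq, ← mul_pow, Lp.enorm_def]
          gcongr
          exact enorm_integral_mul_le (hKx x).aestronglyMeasurable (Lp.aestronglyMeasurable u)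
      _ = (∫⁻ x, ∫⁻ s, ‖K x s‖ₑ ^ 2 ∂ν ∂μ) * ‖u‖ₑ ^ 2 := lintegral_mul_const' _ _ (by simp)
      _ ≤ _ := by gcongr
  have hT (u : Lp ℂ 2 ν) : MemLp (fun x => ∫ s, K x s * u s ∂ν) 2 μ := by
    refine ⟨?_, (hbound u).trans_lt (ENNReal.mul_lt_top ENNReal.ofReal_lt_top enorm_lt_top)⟩
    have hu : StronglyMeasurable fun p : α × β => K p.1 p.2 * u p.2 :=
      hK.mul ((Lp.stronglyMeasurable u).comp_measurable measurable_snd)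
    exact hu.integral_prod_right'.aestronglyMeasurable
  let T : Lp ℂ 2 ν →ₗ[ℂ] Lp ℂ 2 μ :=
    { toFun := fun u => (hT u).toLp
      map_add' := fun u v => by
        rw [← MemLp.toLp_add, MemLp.toLp_eq_toLp_iff]
        filter_upwards [hint u, hint v] with x hu hv
        rw [Pi.add_apply, ← integral_add hu hv]
        refine integral_congr_ae ?_
        filter_upwards [Lp.coeFn_add u v] with s hs
        rw [hs, Pi.add_apply, mul_add]
      map_smul' := fun c u => by
        rw [RingHom.id_apply, ← MemLp.toLp_const_smul, MemLp.toLp_eq_toLp_iff]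
        refine .of_forall fun x => ?_
        rw [Pi.smul_apply, ← integral_smul]
        refine integral_congr_ae ?_
        filter_upwards [Lp.coeFn_smul c u] with s hs
        rw [hs, Pi.smul_apply, mul_smul_comm] }
  refine ⟨T.mkContinuous (√C) fun u => ?_, fun u => (hT u).coeFn_toLp, ?_⟩
  · have h := ENNReal.toReal_mono (by finiteness) (hbound u)
    rw [ENNReal.toReal_mul, ENNReal.toReal_ofReal (Real.sqrt_nonneg C), toReal_enorm] at h
    exact (Lp.norm_toLp _ (hT u)).trans_le h
  · calc _ ≤ √C ^ 2 := by
          gcongr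
          exact T.mkContinuous_norm_le (Real.sqrt_nonneg C) _
      _ = C := Real.sq_sqrt hC

end HilbertSchmidt

lemma sqrtB_im_pos {z : ℂ} (hz : ¬(z.im = 0 ∧ 0 ≤ z.re)) : 0 < (sqrtB z).im := by
  have hz' : -z ∈ slitPlane := by
    rw [mem_slitPlane_iff, neg_re, neg_im]
    by_contra! h
    exact hz ⟨by linarith [h.2], by linarith [h.1]⟩
  have harg_lt : arg (-z) < Real.pi := (arg_le_pi _).lt_of_ne (mem_slitPlane_iff_arg.mp hz').1
  rw [sqrtB, I_mul_im, cpow_def_of_ne_zero (slitPlane_ne_zero hz'), exp_re]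
  refine mul_pos (Real.exp_pos _) (Real.cos_pos_of_mem_Ioo ⟨?_, ?_⟩) <;>
    simp [log_im] <;> linarith [neg_pi_lt_arg (-z)]

/-- The squared `L²(ℝ³)` norm of the Yukawa-type kernel `e^{-ar} / (4πr)`. -/
lemma lintegral_exp_neg_div_sq {a : ℝ} (ha : 0 < a) :
    ∫⁻ x : EuclideanSpace ℝ (Fin 3),
      ENNReal.ofReal ((Real.exp (-a * ‖x‖) / (4 * Real.pi * ‖x‖)) ^ 2) =
        ENNReal.ofReal (1 / (8 * Real.pi * a)) := by
  set f : ℝ → ℝ := fun r => (Real.exp (-a * r) / (4 * Real.pi * r)) ^ 2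
  have hf : Set.EqOn (fun r : ℝ => (1 / (4 * Real.pi) ^ 2) * Real.exp (-2 * a * r))
      (fun r => r ^ (Module.finrank ℝ (EuclideanSpace ℝ (Fin 3)) - 1) • f r) (Set.Ioi 0) := by
    intro r hr
    have hr : r ≠ 0 := (Set.mem_Ioi.mp hr).ne'
    have he : Real.exp (-2 * a * r) = Real.exp (-a * r) ^ 2 := by
      rw [← Real.exp_nat_mul]
      ring_nf
    simp only [f, finrank_euclideanSpace_fin, smul_eq_mul, he]
    field_simp
  have hneg : -2 * a < 0 := by linarith
  have hint : Integrable (fun x : EuclideanSpace ℝ (Fin 3) => f ‖x‖) := by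
    rw [integrable_fun_norm_addHaar, ← integrableOn_congr_fun hf measurableSet_Ioi]
    exact (integrableOn_exp_mul_Ioi hneg 0).const_mul _
  rw [← ofReal_integral_eq_lintegral_ofReal hint (.of_forall fun x => sq_nonneg _),
    integral_fun_norm_addHaar, ← setIntegral_congr_fun measurableSet_Ioi hf,
    integral_const_mul, integral_exp_mul_Ioi hneg, Measure.real,
    EuclideanSpace.volume_ball_fin_three]
  congr 1
  rw [ENNReal.toReal_mul, ENNReal.toReal_ofReal (by positivity)]
  simp
  field_simp
  norm_num

/-- The modulus of the resolvent kernel `e^{iwr} / (4πr)`. -/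
lemma enorm_kernel_sq (w : ℂ) {r : ℝ} (hr : 0 ≤ r) :
    ‖Complex.exp (Complex.I * w * (r : ℂ)) / (4 * (Real.pi : ℂ) * (r : ℂ))‖ₑ ^ 2 =
      ENNReal.ofReal ((Real.exp (-w.im * r) / (4 * Real.pi * r)) ^ 2) := by
  rw [← ofReal_norm, ← ENNReal.ofReal_pow (norm_nonneg _), norm_div, norm_exp]
  simp [abs_of_nonneg hr, abs_of_pos Real.pi_pos]

theorem G_well_defined_and_norm_bound
    (l : ℝ) (hl : 0 < l) (z : ℂ) (hz : ¬(z.im = 0 ∧ 0 ≤ z.re)) :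
    ∃ G : L2I l →L[ℂ] L2R3,
      (∀ u : L2I l,
        (G u : EuclideanSpace ℝ (Fin 3) → ℂ) =ᵐ[volume] fun y =>
          ∫ s in Set.Icc (0 : ℝ) l,
            Complex.exp (Complex.I * sqrtB z * (‖y - seg s‖ : ℂ))
              / (4 * (Real.pi : ℂ) * (‖y - seg s‖ : ℂ)) * u s) ∧
      ‖G‖ ^ 2 ≤ l / (8 * Real.pi * (sqrtB z).im) := by
  have ha := sqrtB_im_pos hz
  have hseg : Measurable seg := by
    have h : Isometry seg := Isometry.of_dist_eq fun s t =>
      PiLp.dist_single_same 2 (fun _ : Fin 3 => ℝ) 0 s t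
    exact h.continuous.measurable
  have hK : Measurable (Function.uncurry fun (y : EuclideanSpace ℝ (Fin 3)) (s : ℝ) =>
      Complex.exp (Complex.I * sqrtB z * (‖y - seg s‖ : ℂ))
        / (4 * (Real.pi : ℂ) * (‖y - seg s‖ : ℂ))) := by
    unfold Function.uncurry
    fun_prop
  refine exists_integralOperator_of_lintegral_sq_le hK.stronglyMeasurable (by positivity) ?_
  rw [lintegral_lintegral_swap (hK.enorm.pow_const 2).aemeasurable]
  simp_rw [enorm_kernel_sq (sqrtB z) (norm_nonneg _)]
  have htrans (s : ℝ) := lintegral_sub_right_eq_self (μ := volume)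
    (fun x : EuclideanSpace ℝ (Fin 3) =>
      ENNReal.ofReal ((Real.exp (-(sqrtB z).im * ‖x‖) / (4 * Real.pi * ‖x‖)) ^ 2)) (seg s)
  simp_rw [htrans, lintegral_exp_neg_div_sq ha]
  rw [setLIntegral_const, Real.volume_Icc, ← ENNReal.ofReal_mul (by positivity)]
  refine (congrArg ENNReal.ofReal ?_).le
  ring
end
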